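/- Lemma 1 (invariance of π under weighted selection, measure form): let ρ be the measure on S^{M+1} with density x ↦ q₀(x) with respect to μ^{⊗(M+1)} (the joint law of the current point x₀ ∼ π·μ and the M proposals drawn from k(·; x₀)). Then the measure Σ_{i=0}^{M} (x ↦ x_i)_* (w_i · ρ), obtained by selecting the point x_i with probability w_i(x), equals the measure π·μ on S. In other words, a point selected from {x₀, …, x_M} with the version 2 (Barker) weights is again distributed according to π. -/

import Mathlib

open MeasureTheory

/-- `mpQ π k i x = q_i(x) = π(x_i) k(x_{−i}; x_i)`, where `x ∈ S^{M+1}` and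
`x_{−i}` is the vector of the remaining `M` coordinates (in order), and
`k y x` denotes the one-to-M proposal density `k(y₁,…,y_M; x)`. -/
noncomputable def mpQ {S : Type*} {M : ℕ} (π : S → ℝ) (k : (Fin M → S) → S → ℝ)
    (i : Fin (M + 1)) (x : Fin (M + 1) → S) : ℝ :=
  π (x i) * k (fun j => x (i.succAbove j)) (x i)

/-- The version 2 (Barker-type) weights:
`w_i(x) = q_i(x) / Σ_{j=0}^{M} q_j(x)` when `Σ_j q_j(x) > 0`, and
`w_i(x) = 𝟙{i = 0}` otherwise. -/
noncomputable def mpW2 {S : Type*} {M : ℕ} (π : S → ℝ) (k : (Fin M → S) → S → ℝ)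
    (i : Fin (M + 1)) (x : Fin (M + 1) → S) : ℝ :=
  if 0 < ∑ j : Fin (M + 1), mpQ π k j x then
    mpQ π k i x / ∑ j : Fin (M + 1), mpQ π k j x
  else if i = 0 then 1 else 0

section SelectionInvariance

variable {S : Type*} {M : ℕ} {π : S → ℝ} {k : (Fin M → S) → S → ℝ}

/-- A permutation `τ` of `Fin (n + 1)` induces a permutation of `Fin n` on the complements of `i`
and `τ i`. -/
theorem exists_perm_succAbove {n : ℕ} (τ : Equiv.Perm (Fin (n + 1))) (i : Fin (n + 1)) :
    ∃ σ : Equiv.Perm (Fin n), ∀ j, τ (i.succAbove j) = (τ i).succAbove (σ j) := by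
  let e : {x // x ≠ i} ≃ {x // x ≠ τ i} :=
    τ.subtypeEquiv fun a => (τ.injective.ne_iff (x := a) (y := i)).symm
  refine ⟨((finSuccAboveEquiv i).trans e).trans (finSuccAboveEquiv (τ i)).symm,
    fun j => ?_⟩
  have h := (finSuccAboveEquiv (τ i)).apply_symm_apply
    (e ((finSuccAboveEquiv i) j))
  exact (congrArg Subtype.val h).symm

theorem mpQ_comp_perm
    (hk_symm : ∀ (σ : Equiv.Perm (Fin M)) (y : Fin M → S) (x : S), k (y ∘ σ) x = k y x)
    (τ : Equiv.Perm (Fin (M + 1))) (i : Fin (M + 1)) (x : Fin (M + 1) → S) :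
    mpQ π k i (fun j => x (τ j)) = mpQ π k (τ i) x := by
  obtain ⟨σ, hσ⟩ := exists_perm_succAbove τ i
  simp only [mpQ, hσ]
  congr 1
  exact hk_symm σ (fun j => x ((τ i).succAbove j)) (x (τ i))

theorem mpQ_nonneg (hπ : ∀ x, 0 ≤ π x) (hk : ∀ y x, 0 ≤ k y x)
    (i : Fin (M + 1)) (x : Fin (M + 1) → S) : 0 ≤ mpQ π k i x :=
  mul_nonneg (hπ _) (hk _ _)

theorem mpQ_eq_zero_of_sum_eq_zero (hπ : ∀ x, 0 ≤ π x) (hk : ∀ y x, 0 ≤ k y x)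
    {x : Fin (M + 1) → S} (h : ∑ j, mpQ π k j x = 0) (i : Fin (M + 1)) : mpQ π k i x = 0 :=
  (Finset.sum_eq_zero_iff_of_nonneg fun j _ => mpQ_nonneg hπ hk j x).1 h i (Finset.mem_univ i)

theorem mpQ_mul_mpW2 (hπ : ∀ x, 0 ≤ π x) (hk : ∀ y x, 0 ≤ k y x)
    (i l : Fin (M + 1)) (x : Fin (M + 1) → S) :
    mpQ π k l x * mpW2 π k i x = mpQ π k l x * mpQ π k i x / ∑ j, mpQ π k j x := by
  unfold mpW2
  split_ifs with h <;> try rw [mul_div_assoc]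
  all_goals
    have h0 : ∑ j, mpQ π k j x = 0 :=
      le_antisymm (not_lt.1 h) (Finset.sum_nonneg fun j _ => mpQ_nonneg hπ hk j x)
    simp [mpQ_eq_zero_of_sum_eq_zero hπ hk h0]

theorem mpW2_nonneg (hπ : ∀ x, 0 ≤ π x) (hk : ∀ y x, 0 ≤ k y x)
    (i : Fin (M + 1)) (x : Fin (M + 1) → S) : 0 ≤ mpW2 π k i x := by
  unfold mpW2
  split_ifs with h
  · exact div_nonneg (mpQ_nonneg hπ hk i x) h.le
  · exact zero_le_one
  · exact le_rfl

theorem sum_mpW2 (x : Fin (M + 1) → S) : ∑ i, mpW2 π k i x = 1 := by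
  unfold mpW2
  split_ifs with h
  · rw [← Finset.sum_div, div_self h.ne']
  · simp

theorem mpQ_mul_mpW2_comp_swap (hπ : ∀ x, 0 ≤ π x) (hk : ∀ y x, 0 ≤ k y x)
    (hk_symm : ∀ (σ : Equiv.Perm (Fin M)) (y : Fin M → S) (x : S), k (y ∘ σ) x = k y x)
    (i l : Fin (M + 1)) (x : Fin (M + 1) → S) :
    mpQ π k l (fun j => x (Equiv.swap l i j)) * mpW2 π k i (fun j => x (Equiv.swap l i j)) =
      mpQ π k l x * mpW2 π k i x := by
  rw [mpQ_mul_mpW2 hπ hk, mpQ_mul_mpW2 hπ hk]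
  simp only [mpQ_comp_perm hk_symm, Equiv.swap_apply_left,
    Equiv.swap_apply_right, Equiv.sum_comp (Equiv.swap l i) fun j => mpQ π k j x]
  rw [mul_comm (mpQ π k i x)]

variable [MeasurableSpace S]

theorem measurable_mpQ (hπ : Measurable π)
    (hk : Measurable fun p : (Fin M → S) × S => k p.1 p.2) (i : Fin (M + 1)) :
    Measurable (mpQ π k i) := by
  have h : Measurable fun x : Fin (M + 1) → S =>
      ((fun j => x (i.succAbove j), x i) : (Fin M → S) × S) := by fun_prop
  exact (hπ.comp (measurable_pi_apply i)).mul (hk.comp h)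

theorem measurable_mpW2 (hπ : Measurable π)
    (hk : Measurable fun p : (Fin M → S) × S => k p.1 p.2) (i : Fin (M + 1)) :
    Measurable (mpW2 π k i) := by
  have hs : Measurable fun x => ∑ j, mpQ π k j x :=
    Finset.measurable_fun_sum _ fun j _ => measurable_mpQ hπ hk j
  exact Measurable.ite (measurableSet_lt measurable_const hs)
    ((measurable_mpQ hπ hk i).div hs) measurable_const

theorem lintegral_pi_comp_perm {ι : Type*} [Fintype ι] (μ : Measure S) [SigmaFinite μ]
    (σ : Equiv.Perm ι) (f : (ι → S) → ENNReal) :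
    ∫⁻ x, f (fun j => x (σ j)) ∂(Measure.pi fun _ => μ) = ∫⁻ x, f x ∂(Measure.pi fun _ => μ) := by
  have h := measurePreserving_piCongrLeft (fun _ : ι => μ) σ.symm
  refine Eq.trans ?_ (h.lintegral_map_equiv f _).symm
  refine lintegral_congr fun x => congrArg f (funext fun j => ?_)
  simpa using
    (MeasurableEquiv.piCongrLeft_apply_apply σ.symm (β := fun _ => S) x (σ j)).symm

theorem lintegral_ofReal_eq_one {α : Type*} [MeasurableSpace α] {ν : Measure α} {f : α → ℝ}
    (hf : ∀ a, 0 ≤ f a) (h : ∫ a, f a ∂ν = 1) : ∫⁻ a, ENNReal.ofReal (f a) ∂ν = 1 := by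
  have hi : Integrable f ν := by
    by_contra hn
    simp [integral_undef hn] at h
  rw [← ofReal_integral_eq_lintegral_ofReal hi (Filter.Eventually.of_forall hf), h,
    ENNReal.ofReal_one]

/-- The first marginal of the joint law of the current point and its proposals is `π · μ`. -/
theorem lintegral_mul_mpQ_zero (μ : Measure S) [SigmaFinite μ]
    (hπ_meas : Measurable π) (hπ : ∀ x, 0 ≤ π x)
    (hk_meas : Measurable fun p : (Fin M → S) × S => k p.1 p.2) (hk : ∀ y x, 0 ≤ k y x)
    (hk_int : ∀ x : S, ∫ y, k y x ∂(Measure.pi fun _ : Fin M => μ) = 1)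
    {g : S → ENNReal} (hg : Measurable g) :
    ∫⁻ x, g (x 0) * ENNReal.ofReal (mpQ π k 0 x) ∂(Measure.pi fun _ : Fin (M + 1) => μ) =
      ∫⁻ s, g s * ENNReal.ofReal (π s) ∂μ := by
  have h := measurePreserving_piFinSuccAbove (fun _ : Fin (M + 1) => μ) 0
  have hk' : Measurable fun p : S × (Fin M → S) => k p.2 p.1 := hk_meas.comp measurable_swap
  calc
    _ = ∫⁻ p : S × (Fin M → S), g p.1 * ENNReal.ofReal (π p.1 * k p.2 p.1)
          ∂(μ.prod (Measure.pi fun _ : Fin M => μ)) :=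
      (h.lintegral_map_equiv
        (fun p : S × (Fin M → S) => g p.1 * ENNReal.ofReal (π p.1 * k p.2 p.1)) _).symm
    _ = ∫⁻ s, ∫⁻ y, g s * ENNReal.ofReal (π s * k y s) ∂(Measure.pi fun _ : Fin M => μ) ∂μ :=
      lintegral_prod _ (by fun_prop)
    _ = _ := by
      refine lintegral_congr fun s => ?_
      have hks : Measurable fun y => k y s := hk'.comp measurable_prodMk_left
      simp_rw [ENNReal.ofReal_mul (hπ s), ← mul_assoc]
      rw [lintegral_const_mul _ hks.ennreal_ofReal,
        lintegral_ofReal_eq_one (fun y => hk y s) (hk_int s), mul_one]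

end SelectionInvariance

/-- Lemma 1, measure form: let `ρ` be the measure on `S^{M+1}`
with density `q₀` with respect to `μ^{⊗(M+1)}` (the joint law of the current
point `x₀ ∼ π·μ` and the `M` proposals drawn from `k(·; x₀)`).  Then the
measure `Σ_{i=0}^{M} (x ↦ x_i)_*(w_i · ρ)`, obtained by selecting the point
`x_i` with probability `w_i(x)` (the version 2 / Barker weights), equals the
measure `π·μ` on `S`: a point selected from `{x₀, …, x_M}` with the Barker
weights is again distributed according to `π`. -/
theorem lwmcmc_barker_selection_invariant {S : Type*} [MeasurableSpace S]
    (μ : Measure S) [SigmaFinite μ]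
    (π : S → ℝ) (hπ_meas : Measurable π) (hπ_nonneg : ∀ x, 0 ≤ π x)
    (hπ_int : ∫ x, π x ∂μ = 1)
    (M : ℕ) (hM : 1 ≤ M)
    (k : (Fin M → S) → S → ℝ)
    (hk_meas : Measurable fun p : (Fin M → S) × S => k p.1 p.2)
    (hk_nonneg : ∀ y x, 0 ≤ k y x)
    (hk_int : ∀ x : S, ∫ y, k y x ∂(Measure.pi fun _ : Fin M => μ) = 1)
    (hk_symm : ∀ (σ : Equiv.Perm (Fin M)) (y : Fin M → S) (x : S), k (y ∘ σ) x = k y x)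
    (ρ : Measure (Fin (M + 1) → S))
    (hρ : ρ = (Measure.pi fun _ : Fin (M + 1) => μ).withDensity
        (fun x => ENNReal.ofReal (mpQ π k 0 x))) :
    ∑ i : Fin (M + 1),
        Measure.map (fun x => x i) (ρ.withDensity (fun x => ENNReal.ofReal (mpW2 π k i x)))
      = μ.withDensity (fun s => ENNReal.ofReal (π s)) := by
  have hQ : Measurable fun x => ENNReal.ofReal (mpQ π k 0 x) :=
    (measurable_mpQ hπ_meas hk_meas 0).ennreal_ofReal
  have hW : ∀ i, Measurable fun x => ENNReal.ofReal (mpW2 π k i x) := fun i =>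
    (measurable_mpW2 hπ_meas hk_meas i).ennreal_ofReal
  ext A hA
  let g : S → ENNReal := A.indicator 1
  have hg : Measurable g := measurable_one.indicator hA
  have hterm : ∀ i : Fin (M + 1),
      Measure.map (fun x => x i) (ρ.withDensity fun x => ENNReal.ofReal (mpW2 π k i x)) A =
        ∫⁻ x, g (x 0) * ENNReal.ofReal (mpQ π k 0 x * mpW2 π k i x)
          ∂(Measure.pi fun _ : Fin (M + 1) => μ) := by
    intro i
    have hgi : Measurable fun x : Fin (M + 1) → S => g (x i) := hg.comp (measurable_pi_apply i)
    rw [← lintegral_indicator_one hA, lintegral_map hg (measurable_pi_apply i), hρ,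
      ← withDensity_mul _ hQ (hW i), lintegral_withDensity_eq_lintegral_mul _ (hQ.mul (hW i))
        hgi, ← lintegral_pi_comp_perm μ (Equiv.swap 0 i)]
    refine lintegral_congr fun x => ?_
    simp only [Pi.mul_apply, Equiv.swap_apply_right]
    rw [← ENNReal.ofReal_mul (mpQ_nonneg hπ_nonneg hk_nonneg _ _),
      mpQ_mul_mpW2_comp_swap hπ_nonneg hk_nonneg hk_symm, mul_comm]
  have hsum : ∀ x, ∑ i, g (x 0) * ENNReal.ofReal (mpQ π k 0 x * mpW2 π k i x) =
      g (x 0) * ENNReal.ofReal (mpQ π k 0 x) := by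
    intro x
    rw [← Finset.mul_sum, ← ENNReal.ofReal_sum_of_nonneg fun i _ =>
      mul_nonneg (mpQ_nonneg hπ_nonneg hk_nonneg 0 x) (mpW2_nonneg hπ_nonneg hk_nonneg i x),
      ← Finset.mul_sum, sum_mpW2, mul_one]
  have hmeas : ∀ i : Fin (M + 1), Measurable fun x : Fin (M + 1) → S =>
      g (x 0) * ENNReal.ofReal (mpQ π k 0 x * mpW2 π k i x) := fun i =>
    (hg.comp (measurable_pi_apply 0)).mul ((measurable_mpQ hπ_meas hk_meas 0).mul
      (measurable_mpW2 hπ_meas hk_meas i)).ennreal_ofReal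
  rw [Measure.finsetSum_apply, Finset.sum_congr rfl fun i _ => hterm i,
    ← lintegral_finsetSum _ fun i _ => hmeas i,
    lintegral_congr hsum,
    lintegral_mul_mpQ_zero μ hπ_meas hπ_nonneg hk_meas hk_nonneg hk_int hg,
    ← lintegral_indicator_one hA,
    lintegral_withDensity_eq_lintegral_mul _ hπ_meas.ennreal_ofReal hg]
  simp only [Pi.mul_apply, mul_comm]
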